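/- arXiv:1309.2166 — 4 statements merged into one kernel-verified Lean document; each statement's English description precedes it below -/
import Mathlib

section
/- Let h : ℝ^m × ℝ^m → ℝ be differentiable and let α : ℝ^m → ℝ^m be a differentiable map whose Jacobian Dα(q) is a symmetric linear map at every q (i.e. the 1-form α is closed). Then the Hamiltonian vector field X_h(q,p) = (∂h/∂p(q,p), −∂h/∂q(q,p)) is tangent to the graph Γ_α = {(q, α(q)) : q ∈ ℝ^m} at every point if and only if the function q ↦ h(q, α(q)) has zero derivative at every point of ℝ^m (equivalently, it is constant). -/
open scoped RealInnerProductSpace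

/-- For a differentiable Hamiltonian `h` on `ℝ^m × ℝ^m` and a differentiable
map `α : ℝ^m → ℝ^m` with symmetric Jacobian (a closed 1-form), the Hamiltonian vector field
`X_h = (∂h/∂p, −∂h/∂q)` is tangent to the graph of `α` at every point iff the function
`q ↦ h(q, α(q))` has zero derivative everywhere. -/
theorem hamiltonian_tangent_graph_iff_const
    {m : ℕ}
    (h : EuclideanSpace ℝ (Fin m) × EuclideanSpace ℝ (Fin m) → ℝ)
    (hh : Differentiable ℝ h)
    (α : EuclideanSpace ℝ (Fin m) → EuclideanSpace ℝ (Fin m))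
    (hα : Differentiable ℝ α)
    (hsym : ∀ q u v : EuclideanSpace ℝ (Fin m),
      ⟪fderiv ℝ α q u, v⟫ = ⟪fderiv ℝ α q v, u⟫) :
    (∀ q : EuclideanSpace ℝ (Fin m),
      (gradient (fun p ↦ h (q, p)) (α q), -gradient (fun q' ↦ h (q', α q)) q) ∈
        Set.range (fderiv ℝ (fun q' ↦ (q', α q')) q)) ↔
    (∀ q : EuclideanSpace ℝ (Fin m), fderiv ℝ (fun q' ↦ h (q', α q')) q = 0) := by
  refine forall_congr' fun q ↦ ?_
  have hL := (hh (q, α q)).hasFDerivAt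
  have hA := (hα q).hasFDerivAt
  set L := fderiv ℝ h (q, α q) with hLdef
  have hg : HasFDerivAt (fun q' ↦ (q', α q'))
      ((ContinuousLinearMap.id ℝ _).prod (fderiv ℝ α q)) q := (hasFDerivAt_id q).prodMk hA
  have hc : HasFDerivAt (fun q' ↦ h (q', α q'))
      (L.comp ((ContinuousLinearMap.id ℝ _).prod (fderiv ℝ α q))) q :=
    HasFDerivAt.comp (g := h) (f := fun q' ↦ (q', α q')) q hL hg
  have hp : HasFDerivAt (fun p ↦ h (q, p)) (L.comp (ContinuousLinearMap.inr ℝ _ _)) (α q) :=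
    HasFDerivAt.comp (g := h) (f := fun p ↦ (q, p)) (α q) hL (hasFDerivAt_prodMk_right q (α q))
  have hq : HasFDerivAt (fun q' ↦ h (q', α q)) (L.comp (ContinuousLinearMap.inl ℝ _ _)) q :=
    HasFDerivAt.comp (g := h) (f := fun q' ↦ (q', α q)) q hL (hasFDerivAt_prodMk_left q (α q))
  have gp : ∀ v, ⟪gradient (fun p ↦ h (q, p)) (α q), v⟫ = L (0, v) := fun v ↦ by
    rw [gradient, InnerProductSpace.toDual_symm_apply, hp.fderiv]; simp
  have gq : ∀ v, ⟪gradient (fun q' ↦ h (q', α q)) q, v⟫ = L (v, 0) := fun v ↦ by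
    rw [gradient, InnerProductSpace.toDual_symm_apply, hq.fderiv]; simp
  rw [hg.fderiv, hc.fderiv]
  generalize gradient (fun p ↦ h (q, p)) (α q) = a at gp ⊢
  generalize gradient (fun q' ↦ h (q', α q)) q = b at gq ⊢
  have key : ∀ v, L (v, fderiv ℝ α q v) = ⟪fderiv ℝ α q a + b, v⟫ := fun v ↦ by
    rw [inner_add_left, gq, hsym, real_inner_comm, gp, ← map_add]
    simp
  have h1 : ((a, -b) ∈ Set.range ((ContinuousLinearMap.id ℝ _).prod (fderiv ℝ α q))) ↔
      fderiv ℝ α q a + b = 0 := by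
    rw [← eq_neg_iff_add_eq_zero]
    constructor
    · rintro ⟨x, hx⟩
      have e1 : x = a := congrArg Prod.fst hx
      have e2 : fderiv ℝ α q x = -b := congrArg Prod.snd hx
      rw [← e1, e2]
    · intro e
      exact ⟨a, Prod.ext rfl e⟩
  rw [h1]
  constructor
  · intro e
    ext1 v
    change L (v, fderiv ℝ α q v) = 0
    rw [key, e, inner_zero_left]
  · intro e
    have := DFunLike.congr_fun e (fderiv ℝ α q a + b)
    change L (fderiv ℝ α q a + b, fderiv ℝ α q (fderiv ℝ α q a + b)) = 0 at this
    rw [key] at this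
    exact inner_self_eq_zero.mp this
end

section
/- Let h : ℝ^m × ℝ^m → ℝ be differentiable and α : ℝ^m → ℝ^m differentiable, and define the vector field X on ℝ^m by X(q) = ∂h/∂p(q, α(q)). Then the Hamiltonian vector field X_h(q,p) = (∂h/∂p(q,p), −∂h/∂q(q,p)) is tangent to the graph Γ_α at every point if and only if for all q, v ∈ ℝ^m one has ⟨Dα(q)X(q), v⟩ − ⟨Dα(q)v, X(q)⟩ = −D(h ∘ (id, α))(q)(v); i.e. the contraction of the 2-form dα with X equals −d(α*h), where (dα)_q(u,v) = ⟨Dα(q)u, v⟩ − ⟨Dα(q)v, u⟩ and α*h(q) = h(q, α(q)). -/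
open scoped RealInnerProductSpace

/-- With `X(q) = ∂h/∂p(q, α(q))`, the Hamiltonian vector field `X_h` is tangent
to the graph of `α` everywhere iff the contraction of the 2-form `dα` with `X` equals
`−d(α*h)`, i.e. `⟨Dα(q)X(q), v⟩ − ⟨Dα(q)v, X(q)⟩ = −D(h ∘ (id,α))(q)(v)` for all `q, v`. -/
theorem hamiltonian_tangent_graph_iff_contraction
    {m : ℕ}
    (h : EuclideanSpace ℝ (Fin m) × EuclideanSpace ℝ (Fin m) → ℝ)
    (hh : Differentiable ℝ h)
    (α : EuclideanSpace ℝ (Fin m) → EuclideanSpace ℝ (Fin m))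
    (hα : Differentiable ℝ α)
    (X : EuclideanSpace ℝ (Fin m) → EuclideanSpace ℝ (Fin m))
    (hX : ∀ q, X q = gradient (fun p ↦ h (q, p)) (α q)) :
    (∀ q : EuclideanSpace ℝ (Fin m),
      (gradient (fun p ↦ h (q, p)) (α q), -gradient (fun q' ↦ h (q', α q)) q) ∈
        Set.range (fderiv ℝ (fun q' ↦ (q', α q')) q)) ↔
    (∀ q v : EuclideanSpace ℝ (Fin m),
      ⟪fderiv ℝ α q (X q), v⟫ - ⟪fderiv ℝ α q v, X q⟫
        = -(fderiv ℝ (fun q' ↦ h (q', α q')) q v)) := by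
  refine forall_congr' fun q => ?_
  have hH := (hh (q, α q)).hasFDerivAt
  have hA := (hα q).hasFDerivAt
  have h1 : HasFDerivAt (fun q' ↦ (q', α q'))
      ((ContinuousLinearMap.id ℝ _).prod (fderiv ℝ α q)) q := (hasFDerivAt_id q).prodMk hA
  have h2 : HasFDerivAt (fun q' ↦ h (q', α q')) _ q :=
    HasFDerivAt.comp (g := h) (f := fun q' ↦ (q', α q')) q hH h1
  have h3 : HasFDerivAt (fun p ↦ h (q, p)) _ (α q) :=
    HasFDerivAt.comp (g := h) (f := fun p ↦ (q, p)) (α q) hH (hasFDerivAt_prodMk_right q (α q))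
  have h4 : HasFDerivAt (fun q' ↦ h (q', α q)) _ q :=
    HasFDerivAt.comp (g := h) (f := fun q' ↦ (q', α q)) q hH (hasFDerivAt_prodMk_left q (α q))
  have g3 : ∀ w, ⟪X q, w⟫ = fderiv ℝ h (q, α q) (0, w) := by
    intro w
    rw [hX, gradient, InnerProductSpace.toDual_symm_apply, h3.fderiv]
    simp
  have g4 : ∀ w, ⟪gradient (fun q' ↦ h (q', α q)) q, w⟫ = fderiv ℝ h (q, α q) (w, 0) := by
    intro w
    rw [gradient, InnerProductSpace.toDual_symm_apply, h4.fderiv]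
    simp
  have g2 : ∀ v, fderiv ℝ (fun q' ↦ h (q', α q')) q v
      = ⟪gradient (fun q' ↦ h (q', α q)) q, v⟫ + ⟪fderiv ℝ α q v, X q⟫ := by
    intro v
    rw [h2.fderiv, g4, real_inner_comm, g3, ← map_add]
    simp
  rw [h1.fderiv, ← hX]
  constructor
  · rintro ⟨u, hu⟩ v
    simp only [ContinuousLinearMap.prod_apply, ContinuousLinearMap.id_apply, Prod.mk.injEq] at hu
    obtain ⟨rfl, hu⟩ := hu
    rw [g2, hu, inner_neg_left]
    ring
  · intro H
    refine ⟨X q, ?_⟩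
    simp only [ContinuousLinearMap.prod_apply, ContinuousLinearMap.id_apply, Prod.mk.injEq,
      true_and]
    refine ext_inner_right ℝ fun v => ?_
    have := H v
    rw [g2] at this
    rw [inner_neg_left]
    linarith
end

section
/- Let A : ℝ^m × ℝ^m → ℝ^m be a map such that the map Φ : ℝ^m × ℝ^m → ℝ^m × ℝ^m, Φ(λ, x) = (x, A(λ, x)), is a bijection whose inverse is differentiable, and such that for every λ ∈ ℝ^m the map x ↦ A(λ, x) is differentiable with symmetric Jacobian at every point (so each leaf {(x, A(λ,x)) : x ∈ ℝ^m} is the graph of a closed 1-form, i.e. a Lagrangian submanifold). For j = 1, …, m define f_j : ℝ^m × ℝ^m → ℝ as the j-th component of the first (λ-)factor of Φ⁻¹. Then the functions f_1, …, f_m are pairwise in involution with respect to the canonical Poisson bracket: for all i, j and all (q,p) ∈ ℝ^m × ℝ^m, {f_i, f_j}(q,p) = Σ_{k=1}^m ( ∂f_i/∂q_k · ∂f_j/∂p_k − ∂f_i/∂p_k · ∂f_j/∂q_k )(q,p) = 0. -/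
open scoped RealInnerProductSpace

/-- Given a complete solution `Φ(λ,x) = (x, A(λ,x))` of the Hamilton–Jacobi
problem (each `x ↦ A(λ,x)` is a closed 1-form, i.e. has symmetric Jacobian, and `Φ` is a
bijection with differentiable inverse `G`), the component functions `f_j` of the `λ`-factor of
`Φ⁻¹` are pairwise in involution with respect to the canonical Poisson bracket. -/
theorem complete_solution_functions_in_involution
    {m : ℕ}
    (A : EuclideanSpace ℝ (Fin m) → EuclideanSpace ℝ (Fin m) → EuclideanSpace ℝ (Fin m))
    (hA : ∀ lam, Differentiable ℝ (A lam))
    (hAsym : ∀ lam x u v : EuclideanSpace ℝ (Fin m),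
      ⟪fderiv ℝ (A lam) x u, v⟫ = ⟪fderiv ℝ (A lam) x v, u⟫)
    (G : EuclideanSpace ℝ (Fin m) × EuclideanSpace ℝ (Fin m) →
         EuclideanSpace ℝ (Fin m) × EuclideanSpace ℝ (Fin m))
    (hG : Differentiable ℝ G)
    (hGΦ : ∀ lam x : EuclideanSpace ℝ (Fin m), G (x, A lam x) = (lam, x))
    (hΦG : ∀ z : EuclideanSpace ℝ (Fin m) × EuclideanSpace ℝ (Fin m),
      ((G z).2, A (G z).1 (G z).2) = z)
    (f : Fin m → EuclideanSpace ℝ (Fin m) × EuclideanSpace ℝ (Fin m) → ℝ)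
    (hf : ∀ (j : Fin m) z, f j z = (G z).1 j) :
    ∀ (i j : Fin m) (z : EuclideanSpace ℝ (Fin m) × EuclideanSpace ℝ (Fin m)),
      ∑ k : Fin m,
        (fderiv ℝ (f i) z (EuclideanSpace.single k 1, 0) *
           fderiv ℝ (f j) z (0, EuclideanSpace.single k 1) -
         fderiv ℝ (f i) z (0, EuclideanSpace.single k 1) *
           fderiv ℝ (f j) z (EuclideanSpace.single k 1, 0)) = 0 := by
  intro i j z
  obtain ⟨lam, x, rfl⟩ : ∃ lam x, z = (x, A lam x) := ⟨(G z).1, (G z).2, (hΦG z).symm⟩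
  have hdf : ∀ i, DifferentiableAt ℝ (f i) (x, A lam x) := by
    intro i
    have h1 : f i = fun z => (EuclideanSpace.proj i : EuclideanSpace ℝ (Fin m) →L[ℝ] ℝ) (G z).1 := by
      funext z
      simp [hf]
    rw [h1]
    exact (ContinuousLinearMap.differentiableAt _).comp _ (hG _).fst
  have key : ∀ i u, fderiv ℝ (f i) (x, A lam x) (u, fderiv ℝ (A lam) x u) = 0 := by
    intro i u
    have h1 : HasFDerivAt (fun y => (y, A lam y))
        ((ContinuousLinearMap.id ℝ _).prod (fderiv ℝ (A lam) x)) x :=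
      (hasFDerivAt_id x).prodMk (hA lam x).hasFDerivAt
    have h2 := HasFDerivAt.comp x (hdf i).hasFDerivAt h1
    have h3 : (f i ∘ fun y => (y, A lam y)) = fun _ => lam i := by
      funext y
      simp [hf, hGΦ]
    rw [h3] at h2
    have h4 := h2.unique (hasFDerivAt_const (lam i) x)
    simpa using congrArg (fun L => L u) h4
  have exp : ∀ i v, fderiv ℝ (f i) (x, A lam x) (0, v) =
      ∑ l, ⟪v, EuclideanSpace.single l (1:ℝ)⟫ *
        fderiv ℝ (f i) (x, A lam x) (0, EuclideanSpace.single l 1) := by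
    intro i v
    have hv : v = ∑ l, ⟪v, EuclideanSpace.single l (1:ℝ)⟫ • EuclideanSpace.single l (1:ℝ) := by
      have := (EuclideanSpace.basisFun (Fin m) ℝ).sum_repr v
      simpa [EuclideanSpace.inner_single_right] using this.symm
    have h := congrArg
      ((fderiv ℝ (f i) (x, A lam x)).comp (ContinuousLinearMap.inr ℝ _ _)) hv
    rw [map_sum] at h
    simpa only [map_smul, smul_eq_mul, ContinuousLinearMap.comp_apply,
      ContinuousLinearMap.inr_apply] using h
  have hq : ∀ i u, fderiv ℝ (f i) (x, A lam x) (u, 0) =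
      - ∑ l, ⟪fderiv ℝ (A lam) x u, EuclideanSpace.single l (1:ℝ)⟫ *
        fderiv ℝ (f i) (x, A lam x) (0, EuclideanSpace.single l 1) := by
    intro i u
    rw [← exp, eq_neg_iff_add_eq_zero, ← map_add]
    simpa using key i u
  rw [Finset.sum_sub_distrib, sub_eq_zero]
  simp only [hq, neg_mul, mul_neg, Finset.sum_neg_distrib, Finset.sum_mul, Finset.mul_sum]
  rw [Finset.sum_comm]
  congr 1
  refine Finset.sum_congr rfl fun k _ => Finset.sum_congr rfl fun l _ => ?_
  rw [hAsym lam x (EuclideanSpace.single l 1)]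
  ring
end

section
/- Let c₁, c₂, a ∈ ℝ and define W : ℝ × ℝ → ℝ by W(q₀, q₁) = c₂ q₀ + √2 ∫_a^{q₁} √(−t²/2 + c₂ t − c₁) dt (using the real square root). Then for every q₀ ∈ ℝ and every q₁ ∈ ℝ with −q₁²/2 + c₂ q₁ − c₁ ≥ 0, the function W satisfies the one-dimensional second-order Lagrangian Hamilton–Jacobi equation with constant value c₁: q₁ · ∂W/∂q₀(q₀,q₁) − ½ ( q₁² + (∂W/∂q₁(q₀,q₁))² ) = c₁, where ∂W/∂q₀(q₀,q₁) = c₂ and ∂W/∂q₁(q₀,q₁) = √2 · √(−q₁²/2 + c₂ q₁ − c₁) (the latter by the fundamental theorem of calculus). -/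
/-- The Constantelos generating function
`W(q₀,q₁) = c₂q₀ + √2 ∫_a^{q₁} √(−t²/2 + c₂t − c₁) dt` satisfies the one-dimensional
second-order Lagrangian Hamilton–Jacobi equation
`q₁ ∂W/∂q₀ − ½(q₁² + (∂W/∂q₁)²) = c₁` wherever `−q₁²/2 + c₂q₁ − c₁ ≥ 0`, with
`∂W/∂q₀ = c₂` and `∂W/∂q₁ = √2 √(−q₁²/2 + c₂q₁ − c₁)`. -/
theorem javelin_hamilton_jacobi_solution
    (c₁ c₂ a : ℝ) (W : ℝ → ℝ → ℝ)
    (hW : ∀ q₀ q₁ : ℝ, W q₀ q₁ =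
      c₂ * q₀ + Real.sqrt 2 * ∫ t in a..q₁, Real.sqrt (-(t ^ 2) / 2 + c₂ * t - c₁)) :
    ∀ q₀ q₁ : ℝ, 0 ≤ -(q₁ ^ 2) / 2 + c₂ * q₁ - c₁ →
      deriv (fun x ↦ W x q₁) q₀ = c₂ ∧
      deriv (fun y ↦ W q₀ y) q₁ = Real.sqrt 2 * Real.sqrt (-(q₁ ^ 2) / 2 + c₂ * q₁ - c₁) ∧
      q₁ * deriv (fun x ↦ W x q₁) q₀
        - (1 / 2) * (q₁ ^ 2 + (deriv (fun y ↦ W q₀ y) q₁) ^ 2) = c₁ := by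
  intro q₀ q₁ h
  have hc : Continuous fun t : ℝ ↦ Real.sqrt (-(t ^ 2) / 2 + c₂ * t - c₁) := by fun_prop
  have h0 : deriv (fun x ↦ W x q₁) q₀ = c₂ := by
    simp only [hW]
    have := ((hasDerivAt_id q₀).const_mul c₂).add_const
      (Real.sqrt 2 * ∫ t in a..q₁, Real.sqrt (-(t ^ 2) / 2 + c₂ * t - c₁))
    simpa using this.deriv
  have h1 : deriv (fun y ↦ W q₀ y) q₁
      = Real.sqrt 2 * Real.sqrt (-(q₁ ^ 2) / 2 + c₂ * q₁ - c₁) := by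
    simp only [hW]
    exact (((hc.integral_hasStrictDerivAt a q₁).hasDerivAt.const_mul
      (Real.sqrt 2)).const_add (c₂ * q₀)).deriv
  refine ⟨h0, h1, ?_⟩
  rw [h0, h1, mul_pow, Real.sq_sqrt h, Real.sq_sqrt (by norm_num)]
  ring
end
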